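/- Let L n be the number of λ-terms of natural size n. Then for every n ≥ 1 one has, in ℚ: L n = ∑_{k=0}^{⌊(n−1)/2⌋} ((−1)^k / (n−k)) · C(n−k, k) · C(2n−3k, n−2k−1), where C(a,b) denotes the binomial coefficient. -/

import Mathlib

inductive Term : Type
  | idx : ℕ → Term
  | app : Term → Term → Term
  | abs : Term → Term

def Term.size : Term → ℕ
  | .idx n => n + 1
  | .app t u => t.size + u.size + 1
  | .abs t => t.size + 1

noncomputable def L (n : ℕ) : ℕ := Nat.card {t : Term // t.size = n}

theorem algebraMap_inv_mul_natCast_succ (A : Type*) [CommRing A] [Algebra ℚ A] (n : ℕ) :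
    algebraMap ℚ A ((n + 1 : ℚ)⁻¹) * (n + 1) = 1 := by
  rw [← map_natCast (algebraMap ℚ A) n, ← map_one (algebraMap ℚ A), ← map_add, ← map_mul,
    inv_mul_cancel₀ n.cast_add_one_ne_zero]

open Polynomial in
/-- Lagrange inversion over a `ℚ`-algebra, in truncated form: if `f = z * φ(f)`, then `P(f)` is
given modulo `z ^ (N + 1)` by the coefficients of `P' * φ ^ m` for `1 ≤ m ≤ N`. -/
theorem pow_dvd_eval_sub_lagrange {A : Type*} [CommRing A] [Algebra ℚ A] {z f : A} {φ : A[X]}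
    (hf : f = z * φ.eval f) (N : ℕ) (P : A[X]) :
    z ^ (N + 1) ∣ P.eval f - P.coeff 0 - ∑ m ∈ Finset.range N,
      ((m + 1 : ℚ)⁻¹) • (z ^ (m + 1) * (derivative P * φ ^ (m + 1)).coeff m) := by
  induction N using Nat.strong_induction_on generalizing P with
  | _ N ih =>
  induction P using Polynomial.induction_on' with
  | add p q hp hq =>
    convert dvd_add hp hq using 1
    simp only [eval_add, coeff_add, derivative_add, add_mul, mul_add, smul_add,
      Finset.sum_add_distrib]
    ring
  | monomial k a =>
  rcases k with _ | k
  · simp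
  have hcoeff (m : ℕ) : (derivative (monomial (k + 1) a) * φ ^ (m + 1)).coeff m =
      if k ≤ m then a * (k + 1) * (φ ^ (m + 1)).coeff (m - k) else 0 := by
    rw [derivative_monomial, ← C_mul_X_pow_eq_monomial, mul_assoc, coeff_C_mul,
      Nat.add_sub_cancel, coeff_X_pow_mul']
    split_ifs <;> simp
  have heval : (monomial (k + 1) a).eval f = a * (z ^ (k + 1) * (φ ^ (k + 1)).eval f) := by
    rw [eval_monomial, eval_pow, ← mul_pow, ← hf]
  simp only [hcoeff, heval]
  rw [coeff_monomial, if_neg (Nat.succ_ne_zero k), sub_zero]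
  rcases Nat.lt_or_ge k N with hk | hk
  · obtain ⟨M, rfl⟩ := Nat.exists_eq_add_of_lt hk
    have hdvd := (mul_dvd_mul_left (z ^ (k + 1)) (ih M (by omega) (φ ^ (k + 1)))).mul_left a
    rw [← pow_add] at hdvd
    convert hdvd using 1
    · ring
    rw [add_assoc, Finset.sum_range_add, Finset.sum_eq_zero, zero_add, Finset.sum_range_succ']
    · have hterm (m : ℕ) : (((k + (m + 1) : ℕ) + 1 : ℚ)⁻¹) • (z ^ (k + (m + 1) + 1) *
          (a * (k + 1) * (φ ^ (k + (m + 1) + 1)).coeff (m + 1))) = a * (z ^ (k + 1) *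
            (((m + 1 : ℚ)⁻¹) • (z ^ (m + 1) *
              (derivative (φ ^ (k + 1)) * φ ^ (m + 1)).coeff m))) := by
        have hder : ((k + m + 2 : ℕ) : A[X]) * (derivative (φ ^ (k + 1)) * φ ^ (m + 1)) =
            ((k + 1 : ℕ) : A[X]) * derivative (φ ^ (k + (m + 1) + 1)) := by
          simp only [derivative_pow_succ]
          push_cast
          simp only [map_add, map_natCast, map_one]
          ring
        have hder := congrArg (coeff · m) hder
        simp only [coeff_natCast_mul, coeff_derivative] at hder
        have hu := algebraMap_inv_mul_natCast_succ A (k + (m + 1))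
        have hv := algebraMap_inv_mul_natCast_succ A m
        rw [Algebra.smul_def, Algebra.smul_def]
        push_cast at hder hu hv ⊢
        set u := algebraMap ℚ A ((k + (m + 1) + 1 : ℚ)⁻¹)
        set v := algebraMap ℚ A ((m + 1 : ℚ)⁻¹)
        set x := (φ ^ (k + (m + 1) + 1)).coeff (m + 1)
        set y := (derivative (φ ^ (k + 1)) * φ ^ (m + 1)).coeff m
        have key : u * ((k + 1) * x) = v * y := by
          linear_combination (-u * v) * hder - u * (k + 1) * x * hv + v * y * hu
        linear_combination a * z ^ (k + m + 2) * key
      have hu := algebraMap_inv_mul_natCast_succ A k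
      have hzero : (((k + 0 : ℕ) + 1 : ℚ)⁻¹) • (z ^ (k + 0 + 1) *
          (a * (k + 1) * (φ ^ (k + 0 + 1)).coeff 0)) =
            a * (z ^ (k + 1) * (φ ^ (k + 1)).coeff 0) := by
        rw [Algebra.smul_def]
        simp only [add_zero]
        linear_combination a * z ^ (k + 1) * (φ ^ (k + 1)).coeff 0 * hu
      simp only [Nat.le_add_right, if_true, Nat.add_sub_cancel_left, hterm, hzero]
      rw [mul_sub, mul_sub, mul_sub, mul_sub, Finset.mul_sum, Finset.mul_sum]
      ring
    · intro m hm
      rw [if_neg (by have := Finset.mem_range.1 hm; omega), mul_zero, smul_zero]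
  · rw [Finset.sum_eq_zero, sub_zero]
    · exact Dvd.dvd.mul_left ((pow_dvd_pow z (by omega)).mul_right _) _
    · intro m hm
      rw [if_neg (by have := Finset.mem_range.1 hm; omega), mul_zero, smul_zero]

/-- A term of size `n + 1` is the index `n`, an abstraction of a term of size `n`, or an
application of two terms of total size `n`. -/
def Term.sizeSuccEquiv (n : ℕ) : {t : Term // t.size = n + 1} ≃
    Unit ⊕ {t : Term // t.size = n} ⊕ (Σ p : Finset.HasAntidiagonal.antidiagonal n,
      {t : Term // t.size = p.1.1} × {t : Term // t.size = p.1.2}) where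
  toFun
    | ⟨.idx _, _⟩ => .inl ()
    | ⟨.abs t, h⟩ => .inr (.inl ⟨t, by simpa [Term.size] using h⟩)
    | ⟨.app t u, h⟩ => .inr (.inr ⟨⟨(t.size, u.size),
        Finset.HasAntidiagonal.mem_antidiagonal.2 (by simpa [Term.size] using h)⟩,
        ⟨t, rfl⟩, ⟨u, rfl⟩⟩)
  invFun
    | .inl _ => ⟨.idx n, rfl⟩
    | .inr (.inl t) => ⟨.abs t.1, by simp [Term.size, t.2]⟩
    | .inr (.inr ⟨p, t, u⟩) => ⟨.app t.1 u.1, by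
        simp [Term.size, t.2, u.2, Finset.HasAntidiagonal.mem_antidiagonal.1 p.2]⟩
  left_inv := by
    rintro ⟨_ | _ | _, h⟩
    · simp only [Term.size, Nat.add_right_cancel_iff] at h
      simp [h]
    · rfl
    · rfl
  right_inv := by
    rintro (_ | _ | ⟨⟨⟨i, j⟩, hp⟩, ⟨t, ht⟩, ⟨u, hu⟩⟩)
    · rfl
    · rfl
    · dsimp only at ht hu
      subst ht hu
      rfl

theorem Term.size_pos (t : Term) : 0 < t.size := by
  cases t <;> simp [Term.size]

instance Term.isEmpty_size_eq_zero : IsEmpty {t : Term // t.size = 0} :=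
  ⟨fun t => t.1.size_pos.ne' t.2⟩

instance Term.finite_size_eq (n : ℕ) : Finite {t : Term // t.size = n} := by
  induction n using Nat.strong_induction_on with
  | _ n ih =>
  rcases n with _ | n
  · infer_instance
  have := ih n n.lt_succ_self
  have (p : Finset.HasAntidiagonal.antidiagonal n) :
      Finite ({t : Term // t.size = p.1.1} × {t : Term // t.size = p.1.2}) := by
    have hp := Finset.HasAntidiagonal.mem_antidiagonal.1 p.2
    have := ih p.1.1 (by omega)
    have := ih p.1.2 (by omega)
    infer_instance
  exact Finite.of_equiv _ (Term.sizeSuccEquiv n).symm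

theorem L_zero : L 0 = 0 := by
  simp [L]

theorem L_succ (n : ℕ) :
    L (n + 1) = 1 + L n + ∑ p ∈ Finset.HasAntidiagonal.antidiagonal n, L p.1 * L p.2 := by
  rw [L, Nat.card_congr (Term.sizeSuccEquiv n), Nat.card_sum, Nat.card_sum, Nat.card_sigma,
    ← add_assoc]
  simp only [Nat.card_prod, Nat.card_unique]
  rw [Finset.sum_coe_sort (Finset.HasAntidiagonal.antidiagonal n)
    fun p => Nat.card {t : Term // t.size = p.1} * Nat.card {t : Term // t.size = p.2}]
  rfl

/-- The generating function of the numbers `L n`. -/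
noncomputable def genL : PowerSeries ℚ := PowerSeries.mk fun n => (L n : ℚ)

theorem genL_eq_add : genL = PowerSeries.X * PowerSeries.mk 1 + PowerSeries.X * genL +
    PowerSeries.X * genL ^ 2 := by
  ext n
  rcases n with _ | n
  · simp [genL, L_zero]
  · simp only [map_add, PowerSeries.coeff_succ_X_mul]
    simp [genL, L_succ, sq, PowerSeries.coeff_mul]

/-- The kernel `(1 + u) * (1 + u - z * u)` such that the generating function `f` of `L`
satisfies `f = z * φ(f)`. -/
noncomputable def lagrangeKernel : Polynomial (PowerSeries ℚ) :=
  (1 + Polynomial.X) * (1 + Polynomial.X - Polynomial.C PowerSeries.X * Polynomial.X)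

theorem genL_eq_mul_eval : genL = PowerSeries.X * lagrangeKernel.eval genL := by
  have h : PowerSeries.mk (1 : ℕ → ℚ) * (1 - PowerSeries.X) = 1 :=
    PowerSeries.mk_one_mul_one_sub_eq_one ℚ
  simp only [lagrangeKernel, Polynomial.eval_mul, Polynomial.eval_add, Polynomial.eval_sub,
    Polynomial.eval_one, Polynomial.eval_X, Polynomial.eval_C]
  linear_combination (1 - PowerSeries.X) * genL_eq_add + PowerSeries.X * h

theorem lagrangeKernel_pow (m : ℕ) : lagrangeKernel ^ m = ∑ k ∈ Finset.range (m + 1),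
    Polynomial.C (PowerSeries.C ((-1) ^ k * (m.choose k : ℚ)) * PowerSeries.X ^ k) *
      (Polynomial.X ^ k * (1 + Polynomial.X) ^ (2 * m - k)) := by
  have hkernel : lagrangeKernel = (1 + Polynomial.X) *
      (Polynomial.C (PowerSeries.C (-1) * PowerSeries.X) * Polynomial.X +
        (1 + Polynomial.X)) := by
    simp only [lagrangeKernel, map_mul, map_neg, map_one]
    ring
  rw [hkernel, mul_pow, add_pow (Polynomial.C _ * Polynomial.X), Finset.mul_sum]
  refine Finset.sum_congr rfl fun k hk => ?_
  have hk : 2 * m - k = m + (m - k) := by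
    have := Finset.mem_range.1 hk
    omega
  rw [hk, pow_add, mul_pow]
  simp only [map_mul, map_pow, map_neg, map_one, map_natCast]
  ring

theorem coeff_coeff_lagrangeKernel_pow (m j : ℕ) :
    PowerSeries.coeff j ((lagrangeKernel ^ (m + 1)).coeff m) =
      if j ≤ m then (-1) ^ j * ((m + 1).choose j : ℚ) * ((2 * (m + 1) - j).choose (m - j) : ℚ)
      else 0 := by
  rw [lagrangeKernel_pow, Polynomial.finsetSum_coeff, map_sum]
  have hterm (k : ℕ) : PowerSeries.coeff j ((Polynomial.C (PowerSeries.C ((-1) ^ k *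
      ((m + 1).choose k : ℚ)) * PowerSeries.X ^ k) *
      (Polynomial.X ^ k * (1 + Polynomial.X) ^ (2 * (m + 1) - k)) :
        Polynomial (PowerSeries ℚ)).coeff m) = if j = k then (if k ≤ m then
        (-1) ^ k * ((m + 1).choose k : ℚ) * ((2 * (m + 1) - k).choose (m - k) : ℚ) else 0)
        else 0 := by
    rw [Polynomial.coeff_C_mul, Polynomial.coeff_X_pow_mul', mul_assoc, PowerSeries.coeff_C_mul,
      PowerSeries.coeff_X_pow_mul', Polynomial.coeff_one_add_X_pow]
    rcases lt_trichotomy j k with h | rfl | h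
    · rw [if_neg h.not_ge, if_neg h.ne, mul_zero]
    · rw [if_pos le_rfl, if_pos rfl, Nat.sub_self]
      split_ifs <;> simp
    · have hzero (N : ℕ) : PowerSeries.coeff (j - k) (N : PowerSeries ℚ) = 0 := by
        rw [← map_natCast (PowerSeries.C (R := ℚ)), PowerSeries.coeff_C, if_neg (by omega)]
      rw [if_pos h.le, if_neg h.ne']
      split_ifs <;> simp [hzero]
  simp only [hterm, Finset.sum_ite_eq, Finset.mem_range]
  split_ifs <;> first | rfl | omega

theorem L_eq_sum_range (n : ℕ) : (L n : ℚ) = ∑ m ∈ Finset.range n, (m + 1 : ℚ)⁻¹ *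
    if n - (m + 1) ≤ m then (-1) ^ (n - (m + 1)) * ((m + 1).choose (n - (m + 1)) : ℚ) *
      ((2 * (m + 1) - (n - (m + 1))).choose (m - (n - (m + 1))) : ℚ) else 0 := by
  have h := pow_dvd_eval_sub_lagrange genL_eq_mul_eval n Polynomial.X
  have h := PowerSeries.X_pow_dvd_iff.1 h n n.lt_succ_self
  simp only [Polynomial.eval_X, Polynomial.coeff_X_zero, sub_zero, Polynomial.derivative_X,
    one_mul, map_sub, sub_eq_zero, map_sum] at h
  rw [genL, PowerSeries.coeff_mk] at h
  rw [h]
  refine Finset.sum_congr rfl fun m hm => ?_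
  rw [PowerSeries.coeff_smul, PowerSeries.coeff_X_pow_mul',
    if_pos (Nat.succ_le_of_lt (Finset.mem_range.1 hm)),
    coeff_coeff_lagrangeKernel_pow, smul_eq_mul]

theorem L_explicit_formula :
    ∀ n : ℕ, 1 ≤ n →
      (L n : ℚ) = ∑ k ∈ Finset.range ((n - 1) / 2 + 1),
        ((-1 : ℚ) ^ k / ((n - k : ℕ) : ℚ)) * ((n - k).choose k : ℚ) *
          ((2 * n - 3 * k).choose (n - 2 * k - 1) : ℚ) := by
  intro n hn
  rw [L_eq_sum_range, ← Finset.sum_range_reflect]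
  have hsub : Finset.range ((n - 1) / 2 + 1) ⊆ Finset.range n :=
    Finset.range_subset_range.2 (by omega)
  rw [← Finset.sum_subset hsub]
  · refine Finset.sum_congr rfl fun k hk => ?_
    have hk := Finset.mem_range.1 hk
    have hm : n - 1 - k + 1 = n - k := by omega
    have hcast : (((n - 1 - k : ℕ) : ℚ) + 1) = ((n - k : ℕ) : ℚ) := by exact_mod_cast hm
    have hsubsub : n - (n - k) = k := by omega
    rw [hm, hcast, hsubsub, if_pos (by omega), show 2 * (n - k) - k = 2 * n - 3 * k by omega,
      show n - 1 - k - k = n - 2 * k - 1 by omega]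
    ring
  · intro k hk hk'
    rw [Finset.mem_range] at hk hk'
    rw [if_neg (by omega), mul_zero]
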